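/- There exist c > 0 and n₀ such that for all n ≥ n₀, P( sup_{m∈ℝ} | (1/n) Σ_{i=1}^n η(m, x*_i, z_i) − E[η(m, x*_1, z_1)] | ≥ n^{−1/4} ) ≤ exp(−c·n^{1/4}). -/

import Mathlib

open MeasureTheory ProbabilityTheory Real

noncomputable section

/-- The function `η(m,a,b) = a ⟨X⟩`, where `⟨X⟩` is the mean of the probability measure
proportional to `exp(−m̂X²/(2Δ) + X(ma/Δ + √(m̂/Δ) b)) p(dX)`. -/
def eta (p : Measure ℝ) (Δ mhat : ℝ) (m a b : ℝ) : ℝ :=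
  a * ((∫ x, x * Real.exp (-(mhat * x ^ 2) / (2 * Δ)
          + x * (m * a / Δ + Real.sqrt (mhat / Δ) * b)) ∂p)
      / ∫ x, Real.exp (-(mhat * x ^ 2) / (2 * Δ)
          + x * (m * a / Δ + Real.sqrt (mhat / Δ) * b)) ∂p)

theorem integral_eq_sum_of_finset_support {p : Measure ℝ} [IsFiniteMeasure p] {s : Finset ℝ}
    (hs : p (↑s : Set ℝ)ᶜ = 0) (g : ℝ → ℝ) :
    ∫ x, g x ∂p = ∑ x ∈ s, p.real {x} * g x := by
  have h : p.restrict (↑s : Set ℝ) = p := Measure.restrict_eq_self_of_ae_mem hs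
  rw [← h, setIntegral_finset]
  · simp [h]
  · exact IntegrableOn.finset

/-- Gibbs mean of `x` under the weights `w x * exp (x * θ)` on a finite set. -/
def gibbsMean (s : Finset ℝ) (w : ℝ → ℝ) (θ : ℝ) : ℝ :=
  (∑ x ∈ s, w x * (x * exp (x * θ))) / ∑ x ∈ s, w x * exp (x * θ)

section gibbsMean

variable {s : Finset ℝ} {w : ℝ → ℝ}

theorem gibbsMean_partition_pos (hw : ∀ x ∈ s, 0 ≤ w x) (hw' : ∃ x ∈ s, 0 < w x) (θ : ℝ) :
    0 < ∑ x ∈ s, w x * exp (x * θ) := by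
  obtain ⟨x, hx, hwx⟩ := hw'
  exact Finset.sum_pos' (fun y hy => mul_nonneg (hw y hy) (exp_pos _).le)
    ⟨x, hx, mul_pos hwx (exp_pos _)⟩

theorem monotone_gibbsMean (hw : ∀ x ∈ s, 0 ≤ w x) (hw' : ∃ x ∈ s, 0 < w x) :
    Monotone (gibbsMean s w) := by
  intro θ τ h
  unfold gibbsMean
  rw [div_le_div_iff₀ (gibbsMean_partition_pos hw hw' θ) (gibbsMean_partition_pos hw hw' τ),
    Finset.sum_mul_sum, Finset.sum_mul_sum, ← sub_nonpos, ← Finset.sum_sub_distrib]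
  simp_rw [← Finset.sum_sub_distrib]
  set T := ∑ x ∈ s, ∑ y ∈ s, (w x * (x * exp (x * θ)) * (w y * exp (y * τ)) -
    w x * (x * exp (x * τ)) * (w y * exp (y * θ))) with hT
  have hsymm : T = ∑ x ∈ s, ∑ y ∈ s, (w y * (y * exp (y * θ)) * (w x * exp (x * τ)) -
    w y * (y * exp (y * τ)) * (w x * exp (x * θ))) := Finset.sum_comm
  have hadd : T + T ≤ 0 := by
    nth_rewrite 2 [hsymm]
    rw [hT, ← Finset.sum_add_distrib]
    refine Finset.sum_nonpos fun x hx => ?_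
    rw [← Finset.sum_add_distrib]
    refine Finset.sum_nonpos fun y hy => ?_
    have key : (x - y) * (exp (x * θ) * exp (y * τ) - exp (x * τ) * exp (y * θ)) ≤ 0 := by
      rw [← exp_add, ← exp_add]
      rcases le_total x y with hxy | hxy
      · refine mul_nonpos_of_nonpos_of_nonneg (by linarith) (sub_nonneg.2 (exp_le_exp.2 ?_))
        nlinarith
      · refine mul_nonpos_of_nonneg_of_nonpos (by linarith) (sub_nonpos.2 (exp_le_exp.2 ?_))
        nlinarith
    have := mul_nonpos_of_nonneg_of_nonpos (mul_nonneg (hw x hx) (hw y hy)) key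
    linarith
  linarith

theorem abs_gibbsMean_le (hw : ∀ x ∈ s, 0 ≤ w x) (hw' : ∃ x ∈ s, 0 < w x) {R : ℝ}
    (hR : ∀ x ∈ s, |x| ≤ R) (θ : ℝ) : |gibbsMean s w θ| ≤ R := by
  have hpos := gibbsMean_partition_pos hw hw' θ
  unfold gibbsMean
  rw [abs_div, abs_of_pos hpos, div_le_iff₀ hpos, Finset.mul_sum]
  refine (Finset.abs_sum_le_sum_abs _ _).trans (Finset.sum_le_sum fun x hx => ?_)
  rw [abs_mul, abs_mul, abs_of_nonneg (hw x hx), abs_exp]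
  have := mul_le_mul_of_nonneg_right (hR x hx) (mul_nonneg (hw x hx) (exp_pos (x * θ)).le)
  linarith

theorem continuous_gibbsMean (hw : ∀ x ∈ s, 0 ≤ w x) (hw' : ∃ x ∈ s, 0 < w x) :
    Continuous (gibbsMean s w) := by
  unfold gibbsMean
  exact Continuous.div (by fun_prop) (by fun_prop)
    fun θ => (gibbsMean_partition_pos hw hw' θ).ne'

end gibbsMean

theorem eta_eq_mul_gibbsMean {p : Measure ℝ} [IsFiniteMeasure p] {s : Finset ℝ}
    (hs : p (↑s : Set ℝ)ᶜ = 0) (Δ mhat m a b : ℝ) :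
    eta p Δ mhat m a b = a * gibbsMean s
      (fun x => p.real {x} * exp (-(mhat * x ^ 2) / (2 * Δ)))
      (m * a / Δ + Real.sqrt (mhat / Δ) * b) := by
  unfold eta gibbsMean
  rw [integral_eq_sum_of_finset_support hs, integral_eq_sum_of_finset_support hs]
  congr 2
  · exact Finset.sum_congr rfl fun x _ => by rw [exp_add]; ring
  · exact Finset.sum_congr rfl fun x _ => by rw [exp_add]; ring

theorem exists_real_singleton_pos {p : Measure ℝ} [IsProbabilityMeasure p] {s : Finset ℝ}
    (hs : p (↑s : Set ℝ)ᶜ = 0) : ∃ x ∈ s, 0 < p.real {x} := by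
  by_contra! h
  have h1 := integral_eq_sum_of_finset_support hs (fun _ => 1)
  simp only [integral_const, probReal_univ, smul_eq_mul, mul_one] at h1
  linarith [Finset.sum_nonpos h]

theorem monotone_eta {p : Measure ℝ} [IsProbabilityMeasure p] {s : Finset ℝ}
    (hs : p (↑s : Set ℝ)ᶜ = 0) {Δ : ℝ} (hΔ : 0 < Δ) (mhat a b : ℝ) :
    Monotone fun m => eta p Δ mhat m a b := by
  obtain ⟨x, hx, hpx⟩ := exists_real_singleton_pos hs
  have hmono := monotone_gibbsMean (s := s)
    (w := fun x => p.real {x} * exp (-(mhat * x ^ 2) / (2 * Δ)))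
    (fun x _ => by positivity) ⟨x, hx, by positivity⟩
  intro m m' h
  simp only [eta_eq_mul_gibbsMean hs]
  rcases le_total 0 a with ha | ha
  · refine mul_le_mul_of_nonneg_left (hmono ?_) ha
    gcongr
  · refine mul_le_mul_of_nonpos_left (hmono ?_) ha
    have := div_le_div_of_nonneg_right (mul_le_mul_of_nonpos_right h ha) hΔ.le
    linarith

theorem abs_eta_le {p : Measure ℝ} [IsProbabilityMeasure p] {s : Finset ℝ}
    (hs : p (↑s : Set ℝ)ᶜ = 0) {R : ℝ} (hR : ∀ x ∈ s, |x| ≤ R) (Δ mhat m : ℝ) {a : ℝ}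
    (ha : a ∈ s) (b : ℝ) : |eta p Δ mhat m a b| ≤ R * R := by
  obtain ⟨x, hx, hpx⟩ := exists_real_singleton_pos hs
  rw [eta_eq_mul_gibbsMean hs, abs_mul]
  exact mul_le_mul (hR a ha) (abs_gibbsMean_le (fun x _ => by positivity)
    ⟨x, hx, by positivity⟩ hR _) (abs_nonneg _) ((abs_nonneg _).trans (hR a ha))

theorem continuous_eta {p : Measure ℝ} [IsProbabilityMeasure p] {s : Finset ℝ}
    (hs : p (↑s : Set ℝ)ᶜ = 0) (Δ mhat : ℝ) :
    Continuous fun q : ℝ × ℝ × ℝ => eta p Δ mhat q.1 q.2.1 q.2.2 := by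
  obtain ⟨x, hx, hpx⟩ := exists_real_singleton_pos hs
  simp only [eta_eq_mul_gibbsMean hs]
  have := continuous_gibbsMean (s := s)
    (w := fun x => p.real {x} * exp (-(mhat * x ^ 2) / (2 * Δ)))
    (fun x _ => by positivity) ⟨x, hx, by positivity⟩
  fun_prop

section UniformConcentration

variable {α : Type*} [MeasurableSpace α] {ν : Measure α} [IsProbabilityMeasure ν]

/-- Two-sided **Hoeffding inequality** for the empirical mean of i.i.d. bounded variables. -/
theorem measureReal_abs_empiricalMean_sub_integral_ge_le {h : α → ℝ} (hm : Measurable h) {B : ℝ}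
    (hB : 0 < B) (hb : ∀ x, |h x| ≤ B) {n : ℕ} (hn : 0 < n) {ε : ℝ} (hε : 0 ≤ ε) :
    (Measure.pi fun _ : Fin n => ν).real
        {ω | ε ≤ |(1 / n) * ∑ i, h (ω i) - ∫ x, h x ∂ν|}
      ≤ 2 * exp (-(n * ε ^ 2) / (2 * B ^ 2)) := by
  have hn' : (0 : ℝ) < n := by exact_mod_cast hn
  have hsub : HasSubgaussianMGF (fun x => h x - ∫ x, h x ∂ν) ((‖B - -B‖₊ / 2) ^ 2) ν :=
    hasSubgaussianMGF_of_mem_Icc hm.aemeasurable (ae_of_all _ fun x => abs_le.1 (hb x))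
  have hc : (((‖B - -B‖₊ / 2) ^ 2 : NNReal) : ℝ) = B ^ 2 := by
    simp only [NNReal.coe_pow, NNReal.coe_div, coe_nnnorm, NNReal.coe_ofNat, Real.norm_eq_abs]
    rw [abs_of_pos (by linarith)]
    ring
  have key : ∀ g : α → ℝ, Measurable g → HasSubgaussianMGF g ((‖B - -B‖₊ / 2) ^ 2) ν →
      (Measure.pi fun _ : Fin n => ν).real {ω | n * ε ≤ ∑ i, g (ω i)}
        ≤ exp (-(n * ε ^ 2) / (2 * B ^ 2)) := by
    intro g hg hgs
    have hind : iIndepFun (fun (i : Fin n) (ω : Fin n → α) => g (ω i))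
        (Measure.pi fun _ : Fin n => ν) :=
      iIndepFun_pi (X := fun _ => g) fun _ => hg.aemeasurable
    have := HasSubgaussianMGF.measure_sum_ge_le_of_iIndepFun hind
      (c := fun _ => (‖B - -B‖₊ / 2) ^ 2) (s := Finset.univ) (fun i _ => by
        refine HasSubgaussianMGF.of_map (X := g) (Y := fun ω : Fin n → α => ω i)
          (measurable_pi_apply i).aemeasurable ?_
        rwa [(measurePreserving_eval (fun _ : Fin n => ν) i).map_eq])
      (mul_nonneg hn'.le hε)
    refine this.trans_eq ?_
    simp only [Finset.sum_const, Finset.card_univ, Fintype.card_fin, hc,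
      nsmul_eq_mul, NNReal.coe_mul, NNReal.coe_natCast]
    congr 1
    field_simp
  have h1 := key _ (hm.sub_const _) hsub
  have h2 := key _ (hm.sub_const _).neg hsub.neg
  have hsubset : {ω : Fin n → α | ε ≤ |(1 / n) * ∑ i, h (ω i) - ∫ x, h x ∂ν|} ⊆
      {ω | n * ε ≤ ∑ i, (h (ω i) - ∫ x, h x ∂ν)} ∪
        {ω | n * ε ≤ ∑ i, (-fun x => h x - ∫ x, h x ∂ν) (ω i)} := by
    intro ω hω
    simp only [Set.mem_ofPred_eq, Set.mem_union, Pi.neg_apply, Finset.sum_neg_distrib,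
      Finset.sum_sub_distrib, Finset.sum_const, Finset.card_univ, Fintype.card_fin,
      nsmul_eq_mul] at hω ⊢
    have hS : ∑ i, h (ω i) - n * ∫ x, h x ∂ν
        = n * ((1 / n) * ∑ i, h (ω i) - ∫ x, h x ∂ν) := by field_simp
    rw [hS, ← mul_neg]
    rcases le_abs.1 hω with h | h
    · exact Or.inl (mul_le_mul_of_nonneg_left h hn'.le)
    · exact Or.inr (mul_le_mul_of_nonneg_left h hn'.le)
  calc _ ≤ _ := measureReal_mono hsubset
    _ ≤ _ := measureReal_union_le _ _
    _ ≤ _ := by linarith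

variable {f : ℝ → α → ℝ} {B : ℝ}

/-- The increasing limit of a bounded monotone family lies above the family, and its integral is
the limit of the integrals. -/
theorem exists_upper_envelope (hmeas : ∀ m, Measurable (f m)) (hmono : ∀ x, Monotone fun m => f m x)
    (hB : ∀ m x, |f m x| ≤ B) :
    ∃ g : α → ℝ, Measurable g ∧ (∀ x, |g x| ≤ B) ∧ (∀ m x, f m x ≤ g x) ∧
      Filter.Tendsto (fun k : ℕ => ∫ x, f k x ∂ν) Filter.atTop (nhds (∫ x, g x ∂ν)) := by
  have hbdd : ∀ x, BddAbove (Set.range fun k : ℕ => f k x) := fun x =>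
    ⟨B, by rintro _ ⟨k, rfl⟩; exact (abs_le.1 (hB k x)).2⟩
  refine ⟨fun x => ⨆ k : ℕ, f k x, Measurable.iSup fun k => hmeas k, fun x => abs_le.2 ⟨?_, ?_⟩,
    fun m x => ?_, ?_⟩
  · exact (abs_le.1 (hB (0 : ℕ) x)).1.trans (le_ciSup (hbdd x) 0)
  · exact ciSup_le fun k => (abs_le.1 (hB k x)).2
  · obtain ⟨k, hk⟩ := exists_nat_ge m
    exact (hmono x hk).trans (le_ciSup (hbdd x) k)
  · refine tendsto_integral_of_dominated_convergence (fun _ => B)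
      (fun k => (hmeas k).aestronglyMeasurable) (integrable_const _)
      (fun k => ae_of_all _ fun x => hB k x) (ae_of_all _ fun x => ?_)
    exact tendsto_atTop_ciSup (fun i j hij => hmono x (Nat.cast_le.2 hij)) (hbdd x)

/-- The decreasing limit of a bounded monotone family lies below the family, and its integral is
the limit of the integrals. -/
theorem exists_lower_envelope (hmeas : ∀ m, Measurable (f m)) (hmono : ∀ x, Monotone fun m => f m x)
    (hB : ∀ m x, |f m x| ≤ B) :
    ∃ g : α → ℝ, Measurable g ∧ (∀ x, |g x| ≤ B) ∧ (∀ m x, g x ≤ f m x) ∧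
      Filter.Tendsto (fun k : ℕ => ∫ x, f (-k) x ∂ν) Filter.atTop (nhds (∫ x, g x ∂ν)) := by
  obtain ⟨g, hg, hgB, hle, hlim⟩ := exists_upper_envelope (ν := ν) (f := fun m x => -f (-m) x)
    (fun m => (hmeas _).neg) (fun x a b hab => neg_le_neg (hmono x (neg_le_neg hab)))
    (fun m x => by simpa using hB (-m) x)
  refine ⟨fun x => -g x, hg.neg, fun x => by simpa using hgB x, fun m x => ?_, ?_⟩
  · have := hle (-m) x
    simp only [neg_neg] at this
    linarith
  · simpa [integral_neg] using hlim.neg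

/-- A bounded, monotone, continuously parametrized family admits `k + 1` functions such that every
member is bracketed by two of them, with gap at most `2 * B / k` in mean. -/
theorem exists_brackets (hmeas : ∀ m, Measurable (f m)) (hmono : ∀ x, Monotone fun m => f m x)
    (hB : ∀ m x, |f m x| ≤ B) (hcont : ∀ x, Continuous fun m => f m x) {k : ℕ} (hk : 0 < k) :
    ∃ h : ℕ → α → ℝ, (∀ j, Measurable (h j)) ∧ (∀ j x, |h j x| ≤ B) ∧
      ∀ m, ∃ i ≤ k, ∃ j ≤ k, (∀ x, h i x ≤ f m x) ∧ (∀ x, f m x ≤ h j x) ∧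
        ∫ x, h j x ∂ν - ∫ x, h i x ∂ν ≤ 2 * B / k := by
  obtain ⟨u, hu, huB, hule, hulim⟩ := exists_upper_envelope (ν := ν) hmeas hmono hB
  obtain ⟨l, hl, hlB, hlle, hllim⟩ := exists_lower_envelope (ν := ν) hmeas hmono hB
  have hk' : (0 : ℝ) < k := by exact_mod_cast hk
  have hint : ∀ {g : α → ℝ}, Measurable g → (∀ x, |g x| ≤ B) → Integrable g ν := fun hg hgB =>
    Integrable.of_bound hg.aestronglyMeasurable B (ae_of_all _ hgB)
  have habs : ∀ {g : α → ℝ}, (∀ x, |g x| ≤ B) → |∫ x, g x ∂ν| ≤ B := fun {g} hgB => by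
    simpa using norm_integral_le_of_norm_le_const (μ := ν) (f := g) (C := B) (ae_of_all _ hgB)
  have hB0 : 0 ≤ B := (abs_nonneg _).trans (habs hlB)
  set L := ∫ x, l x ∂ν
  set U := ∫ x, u x ∂ν
  have hLU : L ≤ U := integral_mono (hint hl hlB) (hint hu huB) fun x => (hlle 0 x).trans (hule 0 x)
  have hgap : (U - L) / k ≤ 2 * B / k := by
    gcongr
    linarith [(abs_le.1 (habs hlB)).1, (abs_le.1 (habs huB)).2]
  have hF : Continuous fun m => ∫ x, f m x ∂ν :=
    continuous_of_dominated (bound := fun _ => B) (fun m => (hmeas m).aestronglyMeasurable)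
      (fun m => ae_of_all _ fun x => hB m x) (integrable_const _) (ae_of_all _ hcont)
  have hlevel : ∀ j : ℕ, ∃ g : α → ℝ, Measurable g ∧ (∀ x, |g x| ≤ B) ∧
      (∀ m, (∀ x, g x ≤ f m x) ∨ ∀ x, f m x ≤ g x) ∧ (j = 0 → g = l) ∧
      (j = k → ∀ m x, f m x ≤ g x) ∧ (j ≤ k → ∫ x, g x ∂ν = L + (U - L) * (j / k)) := by
    intro j
    rcases Nat.eq_zero_or_pos j with rfl | hj
    · exact ⟨l, hl, hlB, fun m => Or.inl (hlle m), fun _ => rfl, fun h => absurd h hk.ne,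
        fun _ => by simp [L]⟩
    rcases le_or_gt k j with hjk | hjk
    · refine ⟨u, hu, huB, fun m => Or.inr (hule m), fun h => absurd h hj.ne', fun _ => hule,
        fun h => ?_⟩
      rw [le_antisymm h hjk, div_self hk'.ne']
      simp [U]
    rcases hLU.eq_or_lt with hLU | hLU
    · exact ⟨u, hu, huB, fun m => Or.inr (hule m), fun h => absurd h hj.ne', fun _ => hule,
        fun h => by simp only [← hLU]; simp [hLU, U]⟩
    have hj' : (0 : ℝ) < j := by exact_mod_cast hj
    have hjk' : (j : ℝ) / k < 1 := (div_lt_one hk').2 (by exact_mod_cast hjk)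
    have hjk0 : 0 < (j : ℝ) / k := div_pos hj' hk'
    obtain ⟨a, ha⟩ := (hllim.eventually_lt_const
      (show L < L + (U - L) * (j / k) by nlinarith)).exists
    obtain ⟨b, hb⟩ := (hulim.eventually_const_lt
      (show L + (U - L) * (j / k) < U by nlinarith)).exists
    obtain ⟨m₀, hm₀⟩ := mem_range_of_exists_le_of_exists_ge hF ⟨_, ha.le⟩ ⟨_, hb.le⟩
    exact ⟨f m₀, hmeas m₀, hB m₀,
      fun m => (le_total m₀ m).imp (fun h x => hmono x h) (fun h x => hmono x h),
      fun h => absurd h hj.ne', fun h => absurd h hjk.ne, fun _ => hm₀⟩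
  choose h hh hhB hcomp hzero htop hlev using hlevel
  refine ⟨h, hh, hhB, fun m => ?_⟩
  classical
  have hex : ∃ j, ∀ x, f m x ≤ h j x := ⟨k, htop k rfl m⟩
  have hjk : Nat.find hex ≤ k := Nat.find_min' hex (htop k rfl m)
  obtain h0 | ⟨i, hi⟩ : Nat.find hex = 0 ∨ ∃ i, Nat.find hex = i + 1 := by
    cases Nat.find hex <;> simp
  · refine ⟨0, k.zero_le, 0, k.zero_le, ?_, h0 ▸ Nat.find_spec hex, ?_⟩
    · rw [hzero 0 rfl]
      exact hlle m
    · rw [sub_self]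
      positivity
  · refine ⟨i, by omega, i + 1, hi ▸ hjk, ?_, hi ▸ Nat.find_spec hex, ?_⟩
    · exact (hcomp i m).resolve_right (Nat.find_min hex (by omega))
    · rw [hlev i (by omega), hlev (i + 1) (by omega)]
      refine le_trans (le_of_eq ?_) hgap
      push_cast
      field_simp
      ring

/-- Uniform law of large numbers with an explicit rate for a bounded monotone family. -/
theorem measureReal_iSup_abs_empiricalMean_sub_integral_le (hmeas : ∀ m, Measurable (f m))
    (hmono : ∀ x, Monotone fun m => f m x) (hB0 : 0 < B) (hB : ∀ m x, |f m x| ≤ B)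
    (hcont : ∀ x, Continuous fun m => f m x) {k n : ℕ} (hk : 0 < k) (hn : 0 < n)
    {ε t : ℝ} (hε : 0 ≤ ε) (ht : ε + 2 * B / k < t) :
    (Measure.pi fun _ : Fin n => ν).real
        {ω | t ≤ ⨆ m : ℝ, |(1 / n) * ∑ i, f m (ω i) - ∫ x, f m x ∂ν|}
      ≤ (k + 1) * (2 * exp (-(n * ε ^ 2) / (2 * B ^ 2))) := by
  obtain ⟨h, hh, hhB, hbr⟩ := exists_brackets (ν := ν) hmeas hmono hB hcont hk
  have hint : ∀ {g : α → ℝ}, Measurable g → (∀ x, |g x| ≤ B) → Integrable g ν := fun hg hgB =>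
    Integrable.of_bound hg.aestronglyMeasurable B (ae_of_all _ hgB)
  have hsubset : {ω : Fin n → α | t ≤ ⨆ m : ℝ, |(1 / n) * ∑ i, f m (ω i) - ∫ x, f m x ∂ν|} ⊆
      ⋃ j ∈ Finset.range (k + 1), {ω | ε ≤ |(1 / n) * ∑ i, h j (ω i) - ∫ x, h j x ∂ν|} := by
    intro ω hω
    by_contra hcon
    simp only [Set.mem_iUnion, Set.mem_ofPred_eq, Finset.mem_range, not_exists, not_le,
      Nat.lt_succ_iff] at hcon
    refine (lt_of_le_of_lt (ciSup_le fun m => ?_) ht).not_ge hω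
    obtain ⟨i, hi, j, hj, him, hmj, hgap⟩ := hbr m
    have h1 := abs_lt.1 (hcon i hi)
    have h2 := abs_lt.1 (hcon j hj)
    have h3 : (1 / n : ℝ) * ∑ a, h i (ω a) ≤ (1 / n) * ∑ a, f m (ω a) :=
      mul_le_mul_of_nonneg_left (Finset.sum_le_sum fun a _ => him _) (by positivity)
    have h4 : (1 / n : ℝ) * ∑ a, f m (ω a) ≤ (1 / n) * ∑ a, h j (ω a) :=
      mul_le_mul_of_nonneg_left (Finset.sum_le_sum fun a _ => hmj _) (by positivity)
    have h5 := integral_mono (hint (hh i) (hhB i)) (hint (hmeas m) (hB m)) him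
    have h6 := integral_mono (hint (hmeas m) (hB m)) (hint (hh j) (hhB j)) hmj
    exact abs_le.2 ⟨by linarith, by linarith⟩
  calc _ ≤ _ := measureReal_mono hsubset (measure_ne_top _ _)
    _ ≤ _ := measureReal_biUnion_finset_le _ _
    _ ≤ ∑ j ∈ Finset.range (k + 1), 2 * exp (-(n * ε ^ 2) / (2 * B ^ 2)) :=
      Finset.sum_le_sum fun j _ =>
        measureReal_abs_empiricalMean_sub_integral_ge_le (hh j) hB0 (hhB j) hn hε
    _ = _ := by simp

/-- Uniform concentration at scale `n ^ (-1/4)` for a bounded monotone family. -/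
theorem exists_measureReal_iSup_abs_empiricalMean_sub_integral_le (hmeas : ∀ m, Measurable (f m))
    (hmono : ∀ x, Monotone fun m => f m x) (hB : ∀ m x, |f m x| ≤ B)
    (hcont : ∀ x, Continuous fun m => f m x) :
    ∃ n₀ : ℕ, ∀ n : ℕ, n₀ ≤ n →
      (Measure.pi fun _ : Fin n => ν).real
        {ω | (n : ℝ) ^ (-(1 : ℝ) / 4)
          ≤ ⨆ m : ℝ, |(1 / n) * ∑ i, f m (ω i) - ∫ x, f m x ∂ν|}
        ≤ exp (-1 * (n : ℝ) ^ ((1 : ℝ) / 4)) := by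
  wlog hB1 : 1 ≤ B generalizing B
  · exact this (fun m x => (hB m x).trans (le_max_left B 1)) (le_max_right B 1)
  have hlarge : ∀ᶠ n : ℕ in Filter.atTop, 40 * B ^ 2 ≤ (n : ℝ) ^ ((1 : ℝ) / 4) :=
    ((tendsto_rpow_atTop (by norm_num)).comp tendsto_natCast_atTop_atTop).eventually_ge_atTop _
  obtain ⟨n₀, hn₀⟩ := Filter.eventually_atTop.1 hlarge
  refine ⟨max n₀ 1, fun n hn => ?_⟩
  have hy := hn₀ n ((le_max_left _ _).trans hn)
  have hn0 : 0 < n := (le_max_right _ _).trans hn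
  set y := (n : ℝ) ^ ((1 : ℝ) / 4) with hydef
  have hBB : B ≤ B ^ 2 := by nlinarith
  have hy0 : 0 < y := by nlinarith
  have hny : (n : ℝ) = y ^ 4 := by
    rw [hydef, ← rpow_natCast, ← rpow_mul (by positivity)]
    norm_num
  have hyinv : (n : ℝ) ^ (-(1 : ℝ) / 4) = y⁻¹ := by
    rw [hydef, ← rpow_neg (by positivity)]
    norm_num
  rw [hyinv]
  set k := ⌈8 * B * y⌉₊
  have hk : 8 * B * y ≤ k := Nat.le_ceil _
  have hk0 : (0 : ℝ) < k := lt_of_lt_of_le (by positivity) hk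
  have hk1 : (k : ℝ) < 8 * B * y + 1 := Nat.ceil_lt_add_one (by positivity)
  have hgap : 2 * B / k ≤ y⁻¹ / 4 := by
    rw [div_le_iff₀ hk0]
    calc 2 * B = y⁻¹ / 4 * (8 * B * y) := by field_simp; ring
      _ ≤ _ := by gcongr
  refine (measureReal_iSup_abs_empiricalMean_sub_integral_le (ν := ν) hmeas hmono
    (by linarith) hB hcont (k := k) (by exact_mod_cast hk0) hn0 (ε := y⁻¹ / 2) (by positivity)
    (by have := inv_pos.2 hy0; linarith)).trans ?_
  have hexp : exp (-(n * (y⁻¹ / 2) ^ 2) / (2 * B ^ 2)) ≤ exp (-2 * y) := by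
    refine exp_le_exp.2 ?_
    rw [hny, div_le_iff₀ (by positivity)]
    have : y ^ 4 * (y⁻¹ / 2) ^ 2 = y ^ 2 / 4 := by field_simp; ring
    rw [this]
    nlinarith
  have hpoly : (k + 1 : ℝ) * 2 ≤ exp y := by
    have := quadratic_le_exp_of_nonneg hy0.le
    nlinarith
  calc (k + 1 : ℝ) * (2 * exp (-(n * (y⁻¹ / 2) ^ 2) / (2 * B ^ 2)))
      ≤ (k + 1) * (2 * exp (-2 * y)) := by gcongr
    _ = (k + 1) * 2 * exp (-2 * y) := by ring
    _ ≤ exp y * exp (-2 * y) := by gcongr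
    _ = exp (-1 * y) := by rw [← exp_add]; ring_nf

end UniformConcentration

theorem eta_uniform_concentration
    (p : Measure ℝ) [IsProbabilityMeasure p]
    (hsupp : ∃ s : Finset ℝ, p (↑s : Set ℝ)ᶜ = 0)
    (Δ : ℝ) (hΔ : 0 < Δ) (mhat : ℝ) (hmhat : 0 < mhat) :
    ∃ c : ℝ, 0 < c ∧ ∃ n₀ : ℕ, ∀ n : ℕ, n₀ ≤ n →
      ((Measure.pi fun _ : Fin n => p).prod
          (Measure.pi fun _ : Fin n => gaussianReal 0 1))
        {ω : (Fin n → ℝ) × (Fin n → ℝ) |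
          (n : ℝ) ^ (-(1 : ℝ)/4)
            ≤ ⨆ m : ℝ,
                |(1 / n) * ∑ i, eta p Δ mhat m (ω.1 i) (ω.2 i)
                  - ∫ w : ℝ × ℝ, eta p Δ mhat m w.1 w.2 ∂(p.prod (gaussianReal 0 1))|}
        ≤ ENNReal.ofReal (Real.exp (-c * (n : ℝ) ^ ((1 : ℝ)/4))) := by
  obtain ⟨s, hs⟩ := hsupp
  set ν := p.prod (gaussianReal 0 1)
  set A : Set (ℝ × ℝ) := Prod.fst ⁻¹' (s : Set ℝ)
  have hA : MeasurableSet A := measurable_fst s.measurableSet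
  have hνA : ∀ᵐ w ∂ν, w ∈ A :=
    Measure.quasiMeasurePreserving_fst.ae (show ∀ᵐ x ∂p, x ∈ (s : Set ℝ) from hs)
  obtain ⟨R, hR⟩ : ∃ R : ℝ, ∀ x ∈ s, |x| ≤ R :=
    (s.image abs).exists_le.imp fun R hR x hx => hR _ (Finset.mem_image_of_mem _ hx)
  set f : ℝ → ℝ × ℝ → ℝ := fun m => A.indicator fun w => eta p Δ mhat m w.1 w.2 with hf
  have hfA : ∀ m, ∀ w ∈ A, f m w = eta p Δ mhat m w.1 w.2 := fun m w hw =>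
    Set.indicator_of_mem hw _
  have hfA' : ∀ m, ∀ w ∉ A, f m w = 0 := fun m w hw => Set.indicator_of_notMem hw _
  have hηcont := continuous_eta hs Δ mhat
  have hmeas : ∀ m, Measurable (f m) := fun m =>
    (hηcont.comp (by fun_prop : Continuous fun w : ℝ × ℝ => (m, w.1, w.2))).measurable.indicator hA
  have hmono : ∀ w, Monotone fun m => f m w := by
    intro w
    by_cases hw : w ∈ A
    · simpa only [hfA _ w hw] using monotone_eta hs hΔ mhat w.1 w.2
    · simpa only [hfA' _ w hw] using monotone_const
  have hB : ∀ m w, |f m w| ≤ R * R := by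
    intro m w
    by_cases hw : w ∈ A
    · rw [hfA m w hw]
      exact abs_eta_le hs hR Δ mhat m hw w.2
    · rw [hfA' m w hw, abs_zero]
      exact mul_self_nonneg R
  have hcont : ∀ w, Continuous fun m => f m w := by
    intro w
    by_cases hw : w ∈ A
    · simp only [hfA _ w hw]
      exact hηcont.comp (by fun_prop : Continuous fun m : ℝ => (m, w.1, w.2))
    · simp only [hfA' _ w hw]
      exact continuous_const
  obtain ⟨n₀, hn₀⟩ := exists_measureReal_iSup_abs_empiricalMean_sub_integral_le (ν := ν)
    hmeas hmono hB hcont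
  refine ⟨1, one_pos, n₀, fun n hn => ?_⟩
  have hmp := measurePreserving_arrowProdEquivProdArrow ℝ ℝ (Fin n) (fun _ => p)
    (fun _ => gaussianReal 0 1)
  rw [← hmp.measure_preimage_equiv]
  refine le_trans (measure_mono_ae ?_)
    ((ENNReal.le_ofReal_iff_toReal_le (measure_ne_top _ _) (exp_pos _).le).2 (hn₀ n hn))
  have hae : ∀ᵐ ω ∂(Measure.pi fun _ : Fin n => ν), ∀ i, ω i ∈ A :=
    Filter.eventually_all.2 fun i => Measure.tendsto_eval_ae_ae.eventually hνA
  filter_upwards [hae] with ω hω hmem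
  have hint : ∀ m, ∫ w, f m w ∂ν = ∫ w, eta p Δ mhat m w.1 w.2 ∂ν := fun m =>
    integral_congr_ae (hνA.mono fun w hw => hfA m w hw)
  have hsum : ∀ m, ∑ i, f m (ω i) = ∑ i, eta p Δ mhat m (ω i).1 (ω i).2 := fun m =>
    Finset.sum_congr rfl fun i _ => hfA m _ (hω i)
  change _ ≤ _
  simp only [hint, hsum]
  exact hmem
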